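/- The ideal J is a graded coideal of the bialgebra (𝕀̃(S), Δ, ε): it is a homogeneous ideal with Δ(J) ⊆ J ⊗ 𝕀̃(S) + 𝕀̃(S) ⊗ J and ε(J) = 0. Consequently Δ and ε descend to the quotient 𝕀(S) := 𝕀̃(S)/J, which is thereby a commutative graded Hopf algebra. -/

import Mathlib

/-!
STATEMENT 3. The ideal `J` of `𝕀̃(S)` generated by the shuffle, path composition and loop
relations is a graded coideal: it is homogeneous, `Δ(J) ⊆ J ⊗ 𝕀̃(S) + 𝕀̃(S) ⊗ J`, and
`ε(J) = 0`. Consequently `Δ` and `ε` descend to `𝕀(S) := 𝕀̃(S)/J`, which is thereby a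
commutative graded Hopf algebra.
-/

open scoped TensorProduct

/-- The multiset of all shuffles of two lists. -/
def shuffles {α : Type*} : List α → List α → Multiset (List α)
  | [], l => {l}
  | x :: l, [] => {x :: l}
  | a :: l, b :: m =>
      ((shuffles l (b :: m)).map (a :: ·)) + ((shuffles (a :: l) m).map (b :: ·))
  termination_by l m => l.length + m.length

/-- Generators `𝕀(s₀; s₁, …, s_m; s_{m+1})`, `m ≥ 1`. -/
abbrev IGen (S : Type*) := S × {l : List S // l ≠ []} × S

/-- The free commutative ℚ-algebra `𝕀̃(S)` on the generators `IGen S`. -/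
abbrev Itilde (S : Type*) := MvPolynomial (IGen S) ℚ

/-- The element `𝕀(a; l; b)` of `𝕀̃(S)`, with the convention `𝕀(a; b) = 1`. -/
noncomputable def ISym {S : Type*} (a : S) (l : List S) (b : S) : Itilde S :=
  match l with
  | [] => 1
  | x :: xs => MvPolynomial.X (a, ⟨x :: xs, by simp⟩, b)

/-- The weight of a generator: `𝕀(s₀; s₁, …, s_m; s_{m+1})` has degree `m`. -/
def wdeg {S : Type*} : IGen S → ℕ := fun g => g.2.1.1.length

/-- All markings of a list: decompositions `l = b₀ ++ [c₁] ++ b₁ ++ … ++ [c_k] ++ b_k`. -/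
def marks {α : Type*} : List α → List (List α × List (List α))
  | [] => [([], [[]])]
  | x :: l =>
      ((marks l).map fun p => (x :: p.1, [] :: p.2)) ++
      ((marks l).map fun p => (p.1, (x :: p.2.headI) :: p.2.tail))

/-- `blockProd f a bs cs b = f(a; b₀; c₁) · f(c₁; b₁; c₂) ⋯ f(c_k; b_k; b)`. -/
def blockProd {S M : Type*} [CommMonoid M] (f : S → List S → S → M) :
    S → List (List S) → List S → S → M
  | _, [], _, _ => 1
  | a, [bl], [], b => f a bl b
  | a, bl :: bls, c :: cs, b => f a bl c * blockProd f c bls cs b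
  | _, _ :: _ :: _, [], _ => 1

/-- The coproduct `Δ` of `𝕀̃(S)` (Goncharov's formula on generators). -/
noncomputable def Delta {S : Type*} : Itilde S →ₐ[ℚ] Itilde S ⊗[ℚ] Itilde S :=
  MvPolynomial.aeval fun g : IGen S =>
    ((marks g.2.1.1).map fun p =>
      ISym g.1 p.1 g.2.2 ⊗ₜ[ℚ] blockProd ISym g.1 p.2 p.1 g.2.2).sum

/-- The counit of `𝕀̃(S)`. -/
noncomputable def eps {S : Type*} : Itilde S →ₐ[ℚ] ℚ :=
  MvPolynomial.aeval fun _ : IGen S => 0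

/-- The shuffle product relations. -/
noncomputable def shuffleRel {S : Type*} (a b : S) (l₁ l₂ : List S) : Itilde S :=
  ISym a l₁ b * ISym a l₂ b - ((shuffles l₁ l₂).map fun w => ISym a w b).sum

/-- The path composition relations. -/
noncomputable def pathCompRel {S : Type*} (a b x : S) (l : List S) : Itilde S :=
  ISym a l b - ∑ k ∈ Finset.range (l.length + 1), ISym a (l.take k) x * ISym x (l.drop k) b

/-- The ideal `J` generated by the shuffle, path composition and loop relations. -/
noncomputable def Jideal (S : Type*) : Ideal (Itilde S) :=
  Ideal.span
    ({p | ∃ a b l₁ l₂, p = shuffleRel a b l₁ l₂} ∪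
     {p | ∃ a b x l, p = pathCompRel a b x l} ∪
     {p | ∃ a l, l ≠ [] ∧ p = ISym a l a})

/-- The quotient Hopf algebra `𝕀(S) := 𝕀̃(S)/J`. -/
abbrev IS (S : Type*) := Itilde S ⧸ Jideal S

section Helpers
variable {S R : Type*} [CommRing R]

/-- Sum over all deconcatenations `l = u ++ v`. -/
def Cv (H : List S → List S → R) : List S → R
  | [] => H [] []
  | x :: l => H [] (x :: l) + Cv (fun u v => H (x :: u) v) l

/-- Sum over all decompositions `l = u ++ c :: v`. -/
def Sp (H : List S → S → List S → R) : List S → R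
  | [] => 0
  | x :: l => H [] x l + Sp (fun u c v => H (x :: u) c v) l

/-- Sum over all shuffles. -/
def sh (f : List S → R) (u v : List S) : R := ((shuffles u v).map f).sum

theorem sh_nil_left (f : List S → R) (v : List S) : sh f [] v = f v := by
  simp [sh, shuffles]

theorem sh_nil_right (f : List S → R) (v : List S) : sh f v [] = f v := by
  cases v <;> simp [sh, shuffles]

theorem sh_cons (f : List S → R) (x y : S) (u v : List S) :
    sh f (x :: u) (y :: v) = sh (fun w => f (x :: w)) u (y :: v) +
      sh (fun w => f (y :: w)) (x :: u) v := by
  simp [sh, shuffles, Multiset.map_map]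

theorem sh_add (f g : List S → R) (u v : List S) :
    sh (fun w => f w + g w) u v = sh f u v + sh g u v := by
  simp [sh]

theorem sh_mul_left (r : R) (f : List S → R) (u v : List S) :
    sh (fun w => r * f w) u v = r * sh f u v := by
  simp [sh, Multiset.sum_map_mul_left]

theorem sh_mul_right (r : R) (f : List S → R) (u v : List S) :
    sh (fun w => f w * r) u v = sh f u v * r := by
  simp [sh, Multiset.sum_map_mul_right]

theorem Cv_add (f g : List S → List S → R) (l : List S) :
    Cv (fun u v => f u v + g u v) l = Cv f l + Cv g l := by
  induction l generalizing f g with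
  | nil => rfl
  | cons x l ih => simp only [Cv, ih]; ring

theorem Cv_mul_left (r : R) (f : List S → List S → R) (l : List S) :
    Cv (fun u v => r * f u v) l = r * Cv f l := by
  induction l generalizing f with
  | nil => rfl
  | cons x l ih => simp only [Cv, ih]; ring

theorem Cv_mul_right (r : R) (f : List S → List S → R) (l : List S) :
    Cv (fun u v => f u v * r) l = Cv f l * r := by
  induction l generalizing f with
  | nil => rfl
  | cons x l ih => simp only [Cv, ih]; ring

theorem Sp_add (f g : List S → S → List S → R) (l : List S) :
    Sp (fun u c v => f u c v + g u c v) l = Sp f l + Sp g l := by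
  induction l generalizing f g with
  | nil => simp [Sp]
  | cons x l ih => simp only [Sp, ih]; ring

theorem Sp_mul_left (r : R) (f : List S → S → List S → R) (l : List S) :
    Sp (fun u c v => r * f u c v) l = r * Sp f l := by
  induction l generalizing f with
  | nil => simp [Sp]
  | cons x l ih => simp only [Sp, ih]; ring

theorem Sp_mul_right (r : R) (f : List S → S → List S → R) (l : List S) :
    Sp (fun u c v => f u c v * r) l = Sp f l * r := by
  induction l generalizing f with
  | nil => simp [Sp]
  | cons x l ih => simp only [Sp, ih]; ring

theorem Sp_zero (l : List S) : Sp (fun _ _ _ => (0 : R)) l = 0 := by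
  induction l with
  | nil => rfl
  | cons x l ih => simp [Sp, ih]

/-- Congruence using that the right pieces are shorter. -/
theorem Sp_congr (f g : List S → S → List S → R) (l : List S)
    (h : ∀ u c v, v.length < l.length → f u c v = g u c v) : Sp f l = Sp g l := by
  induction l generalizing f g with
  | nil => rfl
  | cons x l ih =>
    simp only [Sp]
    rw [h [] x l (by simp), ih (fun u c v => f (x :: u) c v) (fun u c v => g (x :: u) c v)]
    intro u c v hv
    exact h _ _ _ (by simp; omega)

theorem Cv_congr (f g : List S → List S → R) (l : List S)
    (h : ∀ u v, v.length ≤ l.length → f u v = g u v) : Cv f l = Cv g l := by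
  induction l generalizing f g with
  | nil => exact h _ _ le_rfl
  | cons x l ih =>
    simp only [Cv]
    rw [h [] (x :: l) le_rfl, ih (fun u v => f (x :: u) v) (fun u v => g (x :: u) v)]
    intro u v hv
    exact h _ _ (by simp; omega)

/-- Iterated splitting. -/
theorem Sp_Sp (H : List S → S → List S → S → List S → R) (l : List S) :
    Sp (fun u c v => Sp (fun v1 d v2 => H u c v1 d v2) v) l =
      Sp (fun u d w => Sp (fun u1 c u2 => H u1 c u2 d w) u) l := by
  induction l generalizing H with
  | nil => rfl
  | cons x l ih =>
    simp only [Sp]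
    rw [Sp_add, ih (fun u c v1 d v2 => H (x :: u) c v1 d v2)]
    simp

theorem Sp_Cv (H : List S → S → List S → List S → R) (l : List S) :
    Sp (fun u c v => Cv (fun v1 v2 => H u c v1 v2) v) l =
      Cv (fun w v2 => Sp (fun u c v1 => H u c v1 v2) w) l := by
  induction l generalizing H with
  | nil => rfl
  | cons x l ih =>
    simp only [Sp, Cv]
    rw [Cv_add, ih (fun u c v1 v2 => H (x :: u) c v1 v2)]
    simp

theorem Cv_Sp (H : List S → List S → S → List S → R) (l : List S) :
    Cv (fun w v => Sp (fun u c v' => H w u c v') v) l =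
      Sp (fun w c v => Cv (fun u1 u2 => H u1 u2 c v) w) l := by
  induction l generalizing H with
  | nil => rfl
  | cons x l ih =>
    simp only [Sp, Cv]
    rw [Sp_add, ih (fun w u c v => H (x :: w) u c v)]
    ring

/-- Deconcatenation is compatible with shuffles. -/
theorem sh_Cv (n : ℕ) (H : List S → List S → R) (u v : List S) (hn : u.length + v.length = n) :
    sh (fun w => Cv H w) u v =
      Cv (fun u1 u2 => Cv (fun v1 v2 => sh (fun w1 => sh (fun w2 => H w1 w2) u2 v2) u1 v1) v) u := by
  induction n generalizing H u v with
  | zero =>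
    obtain rfl : u = [] := by cases u <;> simp_all
    simp [sh_nil_left, Cv]
  | succ n ih =>
    cases u with
    | nil => simp [sh_nil_left, Cv]
    | cons x u =>
    cases v with
    | nil => simp [sh_nil_right, Cv]
    | cons y v =>
      simp only [List.length_cons] at hn
      rw [sh_cons]
      simp only [Cv, sh_add]
      rw [ih (fun u v => H (x :: u) v) u (y :: v) (by simp; omega),
        ih (fun u v => H (y :: u) v) (x :: u) v (by simp; omega)]
      simp only [Cv, sh_cons, Cv_add, sh_nil_left, sh_nil_right]
      ring

theorem sh_Sp (n : ℕ) (H : List S → S → List S → R) (u v : List S)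
    (hn : u.length + v.length = n) :
    sh (fun w => Sp H w) u v =
      Sp (fun u1 c u2 => Cv (fun v1 v2 => sh (fun w1 => sh (fun w2 => H w1 c w2) u2 v2) u1 v1) v) u
      + Sp (fun v1 c v2 => Cv (fun u1 u2 => sh (fun w1 => sh (fun w2 => H w1 c w2) u2 v2) u1 v1) u)
        v := by
  induction n generalizing H u v with
  | zero =>
    obtain rfl : u = [] := by cases u <;> simp_all
    simp [sh_nil_left, Cv, Sp]
  | succ n ih =>
    cases u with
    | nil => simp [sh_nil_left, Cv, Sp]
    | cons x u =>
    cases v with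
    | nil => simp [sh_nil_right, Cv, Sp]
    | cons y v =>
      simp only [List.length_cons] at hn
      rw [sh_cons]
      simp only [Sp, sh_add]
      rw [ih (fun u c v => H (x :: u) c v) u (y :: v) (by simp; omega),
        ih (fun u c v => H (y :: u) c v) (x :: u) v (by simp; omega)]
      simp only [Sp, Cv, sh_cons, Cv_add, Sp_add, sh_nil_left, sh_nil_right]
      ring

/-- First-block variant of `blockProd`. -/
def bpF (G : S → List S → S → R) (g : List S → S → R) (bls : List (List S)) (cs : List S) (b : S) :
    R :=
  match cs with
  | [] => g bls.headI b
  | c :: cs => g bls.headI c * blockProd G c bls.tail cs b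

theorem marks_length (l : List S) : ∀ p ∈ marks l, p.2.length = p.1.length + 1 := by
  induction l with
  | nil => simp [marks]
  | cons x l ih =>
    intro p hp
    simp only [marks, List.mem_append, List.mem_map] at hp
    rcases hp with ⟨q, hq, rfl⟩ | ⟨q, hq, rfl⟩
    · simp [ih q hq]
    · simp [ih q hq]

theorem blockProd_eq_bpF (G : S → List S → S → R) (a : S) (bls : List (List S)) (cs : List S)
    (b : S) (h : bls.length = cs.length + 1) :
    blockProd G a bls cs b = bpF G (G a) bls cs b := by
  cases cs with
  | nil =>
    match bls, h with
    | [bl], _ => rfl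
  | cons c cs =>
    match bls, h with
    | bl :: bls, _ => simp [blockProd, bpF]

/-- The transform by `G`. -/
def T (G : S → List S → S → R) (f : List S → R) (a : S) (l : List S) (b : S) : R :=
  (((marks l : List _) : Multiset (List S × List (List S))).map
    fun p => f p.1 * blockProd G a p.2 p.1 b).sum

theorem T_aux (G : S → List S → S → R) (g : List S → S → R) (f : List S → R) (l : List S) (b : S) :
    ((marks l).map fun p => f p.1 * bpF G g p.2 p.1 b).sum =
      f [] * g l b + Sp (fun u c v => g u c * T G (fun w => f (c :: w)) c v b) l := by
  induction l generalizing g with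
  | nil => simp [marks, bpF, Sp]
  | cons x l ih =>
    have h1 : (fun p : List S × List (List S) => f p.1 *
        bpF G g ((x :: p.2.headI) :: p.2.tail) p.1 b) =
        (fun p => f p.1 * bpF G (fun u c => g (x :: u) c) p.2 p.1 b) := by
      funext p
      cases h : p.1 <;> simp [bpF]
    simp only [marks, List.map_append, List.map_map, List.sum_append, Function.comp_def, h1, ih, Sp]
    simp only [bpF, T, List.headI, List.tail, Multiset.map_coe, Multiset.sum_coe]
    rw [← List.sum_map_mul_left]
    simp only [mul_left_comm]
    ring

theorem T_eq (G : S → List S → S → R) (f : List S → R) (a : S) (l : List S) (b : S) :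
    T G f a l b =
      f [] * G a l b + Sp (fun u c v => G a u c * T G (fun w => f (c :: w)) c v b) l := by
  rw [← T_aux]
  simp only [T, Multiset.map_coe, Multiset.sum_coe]
  congr 1
  apply List.map_congr_left
  intro p hp
  rw [blockProd_eq_bpF _ _ _ _ _ (marks_length l p hp)]

theorem T_add (G : S → List S → S → R) (f g : List S → R) (a : S) (l : List S) (b : S) :
    T G (fun w => f w + g w) a l b = T G f a l b + T G g a l b := by
  simp [T, add_mul]

theorem T_zero (G : S → List S → S → R) (a : S) (l : List S) (b : S) :
    T G (fun _ => 0) a l b = 0 := by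
  simp [T]

theorem T_mul_left (G : S → List S → S → R) (r : R) (f : List S → R) (a : S) (l : List S) (b : S) :
    T G (fun w => r * f w) a l b = r * T G f a l b := by
  simp only [T, mul_assoc, Multiset.sum_map_mul_left]

theorem T_sub (G : S → List S → S → R) (f g : List S → R) (a : S) (l : List S) (b : S) :
    T G (fun w => f w - g w) a l b = T G f a l b - T G g a l b := by
  have h := T_add G f (fun w => (-1) * g w) a l b
  rw [T_mul_left] at h
  simp only [sub_eq_add_neg, neg_one_mul] at h ⊢
  exact h

theorem T_mul_right (G : S → List S → S → R) (r : R) (f : List S → R) (a : S) (l : List S) (b : S) :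
    T G (fun w => f w * r) a l b = T G f a l b * r := by
  simp only [mul_comm _ r, T_mul_left]

theorem T_Sp (G : S → List S → S → R) (H : List S → List S → S → List S → R) (a : S)
    (l : List S) (b : S) (m : List S) :
    T G (fun w => Sp (H w) m) a l b = Sp (fun u c v => T G (fun w => H w u c v) a l b) m := by
  induction m generalizing H with
  | nil => simp [Sp, T_zero]
  | cons x m ih => simp only [Sp, T_add, ih]

theorem T_Cv (G : S → List S → S → R) (H : List S → List S → List S → R) (a : S)
    (l : List S) (b : S) (m : List S) :
    T G (fun w => Cv (H w) m) a l b = Cv (fun u v => T G (fun w => H w u v) a l b) m := by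
  induction m generalizing H with
  | nil => simp [Cv]
  | cons x m ih => simp only [Cv, T_add, ih]

/-- A character: a family satisfying all relations. -/
structure IsChar (G : S → List S → S → R) : Prop where
  nil : ∀ a b, G a [] b = 1
  shuf : ∀ a b u v, sh (fun w => G a w b) u v = G a u b * G a v b
  path : ∀ a x b l, Cv (fun u v => G a u x * G x v b) l = G a l b
  loop : ∀ a l, l ≠ [] → G a l a = 0

theorem T_nil {G : S → List S → S → R} (h0 : ∀ a b, G a [] b = 1) (f : List S → R) (a b : S) :
    T G f a [] b = f [] := by
  rw [T_eq]; simp [Sp, h0]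

/-- Moving the base point. -/
theorem T_base {G : S → List S → S → R} (hG : IsChar G) (f : List S → R) (a x b : S)
    (l : List S) : Cv (fun u v => G a u x * T G f x v b) l = T G f a l b := by
  have : ∀ u v, G a u x * T G f x v b = f [] * (G a u x * G x v b) +
      Sp (fun v1 c v2 => (G a u x * G x v1 c) * T G (fun w => f (c :: w)) c v2 b) v := by
    intro u v
    rw [T_eq]
    simp only [mul_assoc, Sp_mul_left]
    ring
  simp only [this, Cv_add, Cv_mul_left, hG.path, Cv_Sp, Cv_mul_right]
  rw [T_eq]

theorem T_path {G : S → List S → S → R} (hG : IsChar G) (n : ℕ) (F : List S → List S → R)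
    (a x b : S) (l : List S) (hl : l.length = n) :
    T G (fun w => Cv F w) a l b =
      Cv (fun l1 l2 => T G (fun u => T G (fun v => F u v) x l2 b) a l1 x) l := by
  induction n using Nat.strong_induction_on generalizing F a l with
  | _ n ih =>
  rw [T_eq]
  have e : ∀ l1 l2, T G (fun u => T G (fun v => F u v) x l2 b) a l1 x =
      G a l1 x * T G (F []) x l2 b +
      Sp (fun u c u' => G a u c * T G (fun w => T G (fun v => F (c :: w) v) x l2 b) c u' x) l1 := by
    intro l1 l2
    rw [T_eq, mul_comm]
  simp only [e, Cv_add]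
  rw [T_base hG, ← Sp_Cv, T_eq G (F [])]
  simp only [Cv, T_add, Cv_mul_left, mul_add, Sp_add]
  rw [add_assoc]
  congr 2
  apply Sp_congr
  intro u c v hv
  rw [ih v.length (by omega) _ _ _ rfl]

/-- The part of a two-variable function with the first letter of the first argument removed. -/
def hd (K : S → List S → R) : List S → R
  | [] => 0
  | c :: u => K c u

theorem sh_expand (f : List S → R) (u v : List S) :
    sh f u v = f [] * ((if u = [] then 1 else 0) * (if v = [] then 1 else 0)) +
      hd (fun c u' => sh (fun w => f (c :: w)) u' v) u +
      hd (fun d v' => sh (fun w => f (d :: w)) u v') v := by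
  cases u <;> cases v <;> simp [hd, sh_cons, sh_nil_left, sh_nil_right]

theorem T_hd (G : S → List S → S → R) (K : S → List S → R) (a : S) (l : List S) (b : S) :
    T G (hd K) a l b = Sp (fun u c v => G a u c * T G (K c) c v b) l := by
  rw [T_eq]; simp [hd]

theorem T_unit (G : S → List S → S → R) (a : S) (l : List S) (b : S) :
    T G (fun w => if w = [] then 1 else 0) a l b = G a l b := by
  rw [T_eq]; simp [T_zero, Sp_zero]

theorem T_swap (G G' : S → List S → S → R) (F : List S → List S → R) (a a' : S) (l l' : List S)
    (b b' : S) :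
    T G (fun u => T G' (fun v => F u v) a' l' b') a l b =
      T G' (fun v => T G (fun u => F u v) a l b) a' l' b' := by
  simp only [T, ← Multiset.sum_map_mul_right]
  rw [Multiset.sum_map_sum_map]
  simp only [mul_right_comm]

theorem sh_T {G : S → List S → S → R} (hG : IsChar G) (n : ℕ) (f : List S → R) (a b : S)
    (l1 l2 : List S) (hn : l1.length + l2.length = n) :
    sh (fun w => T G f a w b) l1 l2 =
      T G (fun u => T G (fun v => sh f u v) a l2 b) a l1 b := by
  induction n using Nat.strong_induction_on generalizing f a l1 l2 with
  | _ n ih =>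
  have e1 : sh (fun w => T G f a w b) l1 l2 =
      f [] * (G a l1 b * G a l2 b) +
      Sp (fun u1 c u2 => G a u1 c *
        T G (fun u => T G (fun v => sh (fun w => f (c :: w)) u v) a l2 b) c u2 b) l1 +
      Sp (fun v1 c v2 => G a v1 c *
        T G (fun v => T G (fun u => sh (fun w => f (c :: w)) u v) a l1 b) c v2 b) l2 := by
    simp only [T_eq G f]
    rw [sh_add, sh_mul_left, hG.shuf, sh_Sp _ _ _ _ rfl, add_assoc]
    congr 2
    · apply Sp_congr
      intro u1 c u2 hu
      have : ∀ v1 v2, sh (fun w1 => sh (fun w2 => G a w1 c * T G (fun w => f (c :: w)) c w2 b) u2 v2)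
          u1 v1 = G a u1 c * (G a v1 c * sh (fun w2 => T G (fun w => f (c :: w)) c w2 b) u2 v2) := by
        intro v1 v2
        simp only [sh_mul_left, sh_mul_right, hG.shuf]; ring
      simp only [this, Cv_mul_left]
      congr 1
      rw [Cv_congr _ (fun v1 v2 => G a v1 c *
        T G (fun u => T G (fun v => sh (fun w => f (c :: w)) u v) c v2 b) c u2 b)]
      · simp only [← T_mul_left, ← T_Cv]
        simp only [T_mul_left, T_base hG]
      · intro v1 v2 hv
        rw [ih (u2.length + v2.length) (by omega) _ _ _ _ rfl]
    · apply Sp_congr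
      intro v1 c v2 hv
      have : ∀ u1 u2, sh (fun w1 => sh (fun w2 => G a w1 c * T G (fun w => f (c :: w)) c w2 b) u2 v2)
          u1 v1 = G a v1 c * (G a u1 c * sh (fun w2 => T G (fun w => f (c :: w)) c w2 b) u2 v2) := by
        intro u1 u2
        simp only [sh_mul_left, sh_mul_right, hG.shuf]; ring
      simp only [this, Cv_mul_left]
      congr 1
      rw [Cv_congr _ (fun u1 u2 => G a u1 c *
        T G (fun v => T G (fun u => sh (fun w => f (c :: w)) u v) c u2 b) c v2 b)]
      · simp only [← T_mul_left, ← T_Cv]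
        simp only [T_mul_left, T_base hG]
      · intro u1 u2 hu
        rw [ih (u2.length + v2.length) (by omega) _ _ _ _ rfl, T_swap]
  rw [e1]
  simp only [sh_expand f]
  simp only [T_add, T_mul_left, T_mul_right, T_unit]
  congr 1
  · congr 1
    rw [T_swap]
    have : ∀ v, T G (fun u => hd (fun c u' => sh (fun w => f (c :: w)) u' v) u) a l1 b =
      Sp (fun u1 c u2 => G a u1 c * T G (fun u' => sh (fun w => f (c :: w)) u' v) c u2 b) l1 :=
      fun v => T_hd _ _ _ _ _
    simp only [this, T_Sp, T_mul_left]
    congr 1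
    funext u1 c u2
    rw [T_swap]
  · have : ∀ u, T G (fun v => hd (fun d v' => sh (fun w => f (d :: w)) u v') v) a l2 b =
      Sp (fun v1 c v2 => G a v1 c * T G (fun v' => sh (fun w => f (c :: w)) u v') c v2 b) l2 :=
      fun v => T_hd _ _ _ _ _
    simp only [this, T_Sp, T_mul_left]
    congr 1
    funext u1 c u2
    rw [T_swap]

/-- Composition of families. -/
def comp (F G : S → List S → S → R) : S → List S → S → R :=
  fun a l b => T G (fun w => F a w b) a l b

/-- The unit family. -/
def one : S → List S → S → R := fun _ l _ => if l = [] then 1 else 0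

theorem IsChar.comp {F G : S → List S → S → R} (hF : IsChar F) (hG : IsChar G) :
    IsChar (comp F G) where
  nil a b := by simp [_root_.comp, T_nil hG.nil, hF.nil]
  shuf a b u v := by
    simp only [_root_.comp]
    rw [sh_T hG _ _ _ _ _ _ rfl]
    simp only [hF.shuf, T_mul_left, T_mul_right]
  path a x b l := by
    simp only [_root_.comp]
    have h := T_path hG _ (fun u v => F a u x * F x v b) a x b l rfl
    simp only [hF.path, T_mul_left, T_mul_right] at h
    exact h.symm
  loop a l hl := by
    simp only [_root_.comp]
    rw [T_eq]
    simp [hF.loop, hG.loop a l hl, T_zero, Sp_zero]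

theorem one_comp (G : S → List S → S → R) : comp one G = G := by
  funext a l b
  exact T_unit G a l b

theorem T_one (f : List S → R) (a : S) (l : List S) (b : S) : T one f a l b = f l := by
  induction l generalizing f a with
  | nil => rw [T_eq]; simp [one, Sp]
  | cons x l ih =>
    rw [T_eq]
    simp [one, Sp, Sp_zero]
    exact ih _ _

theorem comp_one (F : S → List S → S → R) : comp F one = F := by
  funext a l b
  exact T_one _ a l b

theorem T_Sp_inner (H : S → List S → S → R) (n : ℕ) (K : List S → S → List S → R) (a b : S)
    (l : List S) (hn : l.length = n) :
    T H (fun w => Sp K w) a l b =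
      Sp (fun l1 c l2 => T H (fun u1 => T H (fun u2 => K u1 c u2) c l2 b) a l1 c) l := by
  induction n using Nat.strong_induction_on generalizing K a l with
  | _ n ih =>
  rw [T_eq]
  have e : ∀ l1 c l2, T H (fun u1 => T H (fun u2 => K u1 c u2) c l2 b) a l1 c =
      H a l1 c * T H (K [] c) c l2 b +
      Sp (fun m1 d m2 => H a m1 d *
        T H (fun u1 => T H (fun u2 => K (d :: u1) c u2) c l2 b) d m2 c) l1 := by
    intro l1 c l2
    rw [T_eq, mul_comm]
  simp only [e]
  rw [Sp_add, ← Sp_Sp, ← Sp_add]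
  simp only [Sp, zero_mul, zero_add]
  apply Sp_congr
  intro u c v hv
  rw [T_add, mul_add, ih v.length (by omega) _ _ _ rfl, Sp_mul_left]

theorem T_comp (G H : S → List S → S → R) (n : ℕ) (f : List S → R) (a b : S)
    (l : List S) (hn : l.length = n) :
    T (comp G H) f a l b = T H (fun u => T G f a u b) a l b := by
  induction n using Nat.strong_induction_on generalizing f a l with
  | _ n ih =>
  simp only [T_eq G f]
  rw [T_eq, T_add, T_mul_left, T_Sp_inner _ _ _ _ _ _ rfl]
  congr 1
  apply Sp_congr
  intro u c v hv
  rw [ih v.length (by omega) _ _ _ rfl]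
  simp only [T_mul_left, T_mul_right, comp]

theorem comp_assoc (F G H : S → List S → S → R) : comp (comp F G) H = comp F (comp G H) := by
  funext a l b
  exact (T_comp G H _ _ a b l rfl).symm

theorem T_of_zero {G : S → List S → S → R} (f : List S → R) (a b : S)
    (l : List S) (hf : ∀ w, w.length ≤ l.length → f w = 0) : T G f a l b = 0 := by
  obtain ⟨n, hn⟩ : ∃ n, l.length = n := ⟨_, rfl⟩
  induction n using Nat.strong_induction_on generalizing f a l with
  | _ n ih =>
  rw [T_eq, hf [] (by simp), zero_mul, zero_add, ← Sp_zero (R := R) l]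
  apply Sp_congr
  intro u c v hv
  rw [ih v.length (by omega) _ _ _ _ rfl, mul_zero]
  intro w hw
  exact hf _ (by simp; omega)

theorem T_of_lt {G : S → List S → S → R} (h0 : ∀ a b, G a [] b = 1) (f : List S → R) (a b : S)
    (l : List S) (hf : ∀ w, w.length < l.length → f w = 0) : T G f a l b = f l := by
  induction l generalizing f a with
  | nil => rw [T_nil h0]
  | cons x l ih =>
    rw [T_eq, hf [] (by simp), zero_mul, zero_add]
    simp only [Sp, h0, one_mul]
    rw [ih]
    · rw [Sp_congr _ (fun _ _ _ => 0), Sp_zero, add_zero]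
      intro u c v hv
      rw [T_of_zero, mul_zero]
      intro w hw
      exact hf _ (by simp; omega)
    · intro w hw
      exact hf _ (by simp; omega)

theorem T_inj {G : S → List S → S → R} (h0 : ∀ a b, G a [] b = 1) (f g : List S → R) (a b : S)
    (h : ∀ l, T G f a l b = T G g a l b) : f = g := by
  funext l
  obtain ⟨n, hn⟩ : ∃ n, l.length = n := ⟨_, rfl⟩
  induction n using Nat.strong_induction_on generalizing l with
  | _ n ih =>
  have h1 : T G (fun w => f w - g w) a l b = 0 := by rw [T_sub, h, sub_self]
  rw [T_of_lt h0] at h1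
  · exact sub_eq_zero.mp h1
  · intro w hw
    rw [ih w.length (by omega) w rfl, sub_self]

theorem T_surj {G : S → List S → S → R} (h0 : ∀ a b, G a [] b = 1) (t : List S → R) (a b : S) :
    ∃ f : List S → R, ∀ l, T G f a l b = t l := by
  classical
  have step : ∀ n : ℕ, ∃ f : List S → R, ∀ l, l.length < n → T G f a l b = t l := by
    intro n
    induction n with
    | zero => exact ⟨fun _ => 0, fun l hl => absurd hl (by simp)⟩
    | succ n ih =>
      obtain ⟨f, hf⟩ := ih
      refine ⟨fun w => f w + (if w.length = n then t w - T G f a w b else 0), fun l hl => ?_⟩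
      rw [T_add]
      rcases Nat.lt_succ_iff_lt_or_eq.mp hl with h | h
      · rw [hf l h, T_of_zero, add_zero]
        intro w hw
        exact if_neg (by omega)
      · rw [T_of_lt h0 (fun w => if w.length = n then t w - T G f a w b else 0), if_pos h]
        · ring
        · intro w hw
          exact if_neg (by omega)
  choose F hF using step
  have uniq : ∀ w : List S, ∀ m n, w.length < m → w.length < n → F m w = F n w := by
    intro w
    obtain ⟨k, hk⟩ : ∃ k, w.length = k := ⟨_, rfl⟩
    induction k using Nat.strong_induction_on generalizing w with
    | _ k ih =>
    intro m n hm hn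
    have h1 : T G (fun w => F m w - F n w) a w b = 0 := by
      rw [T_sub, hF m w hm, hF n w hn, sub_self]
    rw [T_of_lt h0] at h1
    · exact sub_eq_zero.mp h1
    · intro w' hw'
      rw [ih w'.length (by omega) w' rfl m n (by omega) (by omega), sub_self]
  refine ⟨fun w => F (w.length + 1) w, fun l => ?_⟩
  rw [← hF (l.length + 1) l (by omega), ← sub_eq_zero, ← T_sub]
  apply T_of_zero
  intro w hw
  rw [uniq w _ (l.length + 1) (by omega) (by omega), sub_self]

/-- Characters have left inverses that are characters. -/
theorem exists_left_inv {G : S → List S → S → R} (hG : IsChar G) :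
    ∃ L : S → List S → S → R, IsChar L ∧ comp L G = one := by
  choose f hf using fun a b => T_surj hG.nil (fun l : List S => if l = [] then (1 : R) else 0) a b
  have hone : ∀ u v : List S, sh (fun w : List S => if w = [] then (1 : R) else 0) u v =
      (if u = [] then 1 else 0) * (if v = [] then 1 else 0) := by
    intro u v
    cases u <;> cases v <;> simp [sh_nil_left, sh_nil_right, sh_cons]
    simp [sh]
  have hcv : ∀ l : List S, Cv (fun u v : List S => (if u = [] then (1 : R) else 0) *
      (if v = [] then 1 else 0)) l = if l = [] then 1 else 0 := by
    intro l
    cases l with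
    | nil => simp [Cv]
    | cons x l =>
      simp only [Cv]
      simp
      have := Cv_mul_left (0 : R) (fun _ _ => 0) l
      simpa using this
  refine ⟨fun a l b => f a b l, ⟨?_, ?_, ?_, ?_⟩, ?_⟩
  · intro a b
    have := hf a b []
    rw [T_nil hG.nil] at this
    simpa using this
  · intro a b u v
    have h1 : ∀ v, (fun u => T G (fun v => sh (f a b) u v) a v b) =
        fun u => f a b u * (if v = [] then 1 else 0) := by
      intro v
      apply T_inj hG.nil _ _ a b
      intro l
      rw [← sh_T hG _ _ _ _ _ _ rfl]
      simp only [hf, hone, T_mul_right]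
    have h2 : ∀ u, (fun v => sh (f a b) u v) = fun v => f a b u * f a b v := by
      intro u
      apply T_inj hG.nil _ _ a b
      intro l
      rw [T_mul_left, hf]
      exact congrFun (h1 l) u
    exact congrFun (h2 u) v
  · intro a x b l
    have : (fun w => Cv (fun u v => f a x u * f x b v) w) = f a b := by
      apply T_inj hG.nil _ _ a b
      intro l
      rw [T_path hG _ _ a x b l rfl]
      simp only [T_mul_left, T_mul_right, hf, hcv]
    exact congrFun this l
  · intro a l hl
    have : f a a = fun w => if w = [] then 1 else 0 := by
      apply T_inj hG.nil _ _ a a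
      intro l
      rw [hf, T_unit]
      split_ifs with h
      · rw [h, hG.nil]
      · rw [hG.loop a l h]
    simp [this, hl]
  · funext a l b
    exact hf a b l

theorem exists_inv {G : S → List S → S → R} (hG : IsChar G) :
    ∃ L : S → List S → S → R, IsChar L ∧ comp L G = one ∧ comp G L = one := by
  obtain ⟨L, hL, h1⟩ := exists_left_inv hG
  obtain ⟨M, hM, h2⟩ := exists_left_inv hL
  refine ⟨L, hL, h1, ?_⟩
  have : M = G := by
    rw [← comp_one M, ← h1, ← comp_assoc, h2, one_comp]
  rwa [this] at h2
end Helpers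

section Final
variable {S : Type*}

theorem sum_range_eq_Cv {R : Type*} [CommRing R] (H : List S → List S → R) (l : List S) :
    ∑ k ∈ Finset.range (l.length + 1), H (l.take k) (l.drop k) = Cv H l := by
  induction l generalizing H with
  | nil => simp [Cv]
  | cons x l ih =>
    rw [List.length_cons, Finset.sum_range_succ']
    simp only [List.take_succ_cons, List.drop_succ_cons, List.take_zero, List.drop_zero, Cv]
    rw [ih (fun u v => H (x :: u) v), add_comm]

/-- Evaluation of a family. -/
noncomputable def ev {R : Type*} [CommRing R] [Algebra ℚ R] (G : S → List S → S → R) :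
    Itilde S →ₐ[ℚ] R :=
  MvPolynomial.aeval fun g => G g.1 g.2.1.1 g.2.2

theorem ev_ISym {R : Type*} [CommRing R] [Algebra ℚ R] (G : S → List S → S → R)
    (h0 : ∀ a b, G a [] b = 1) (a : S) (l : List S) (b : S) : ev G (ISym a l b) = G a l b := by
  cases l with
  | nil => simp [ISym, h0]
  | cons x l => simp [ISym, ev]

theorem X_eq_ISym (g : IGen S) :
    (MvPolynomial.X g : Itilde S) = ISym g.1 g.2.1.1 g.2.2 := by
  obtain ⟨a, ⟨l, hl⟩, b⟩ := g
  cases l with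
  | nil => exact absurd rfl hl
  | cons x l => rfl

theorem hom_ext_ISym {R : Type*} [CommRing R] [Algebra ℚ R] {f g : Itilde S →ₐ[ℚ] R}
    (h : ∀ a l b, f (ISym a l b) = g (ISym a l b)) : f = g := by
  apply MvPolynomial.algHom_ext
  intro i
  rw [X_eq_ISym, h]

theorem J_le_of_char {R : Type*} [CommRing R] [Algebra ℚ R] (f : Itilde S →ₐ[ℚ] R)
    (h : IsChar (fun a l b => f (ISym a l b))) : ∀ x ∈ Jideal S, f x = 0 := by
  have : Jideal S ≤ RingHom.ker f := by
    rw [Jideal, Ideal.span_le]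
    rintro p ((⟨a, b, l₁, l₂, rfl⟩ | ⟨a, b, x, l, rfl⟩) | ⟨a, l, hl, rfl⟩)
    · have := h.shuf a b l₁ l₂
      simp only [sh] at this
      simp [shuffleRel, RingHom.mem_ker, map_multiset_sum, Multiset.map_map, this]
    · have := h.path a x b l
      simp only [SetLike.mem_coe, pathCompRel, RingHom.mem_ker, map_sub, map_sum, map_mul]
      rw [sum_range_eq_Cv (fun u v => f (ISym a u x) * f (ISym x v b)) l, this, sub_self]
    · exact h.loop a l hl
  intro x hx
  exact this hx

theorem mk_char : IsChar (fun (a : S) l b => Ideal.Quotient.mkₐ ℚ (Jideal S) (ISym a l b)) where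
  nil a b := by simp [ISym]
  shuf a b u v := by
    have : shuffleRel a b u v ∈ Jideal S :=
      Ideal.subset_span (Or.inl (Or.inl ⟨a, b, u, v, rfl⟩))
    have h := Ideal.Quotient.eq_zero_iff_mem.mpr this
    rw [shuffleRel, map_sub, sub_eq_zero, map_mul, map_multiset_sum, Multiset.map_map] at h
    exact h.symm
  path a x b l := by
    have : pathCompRel a b x l ∈ Jideal S :=
      Ideal.subset_span (Or.inl (Or.inr ⟨a, b, x, l, rfl⟩))
    have h := Ideal.Quotient.eq_zero_iff_mem.mpr this
    rw [pathCompRel, map_sub, sub_eq_zero, map_sum] at h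
    simp only [map_mul] at h
    rw [← sum_range_eq_Cv]
    exact h.symm
  loop a l hl := Ideal.Quotient.eq_zero_iff_mem.mpr (Ideal.subset_span (Or.inr ⟨a, l, hl, rfl⟩))

theorem IsChar.map {R R' : Type*} [CommRing R] [CommRing R'] [Algebra ℚ R] [Algebra ℚ R']
    {G : S → List S → S → R} (hG : IsChar G) (f : R →ₐ[ℚ] R') :
    IsChar (fun a l b => f (G a l b)) where
  nil a b := by simp [hG.nil]
  shuf a b u v := by
    rw [← map_mul, ← hG.shuf, sh, sh, map_multiset_sum, Multiset.map_map]
    rfl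
  path a x b l := by
    rw [← hG.path a x b l, ← sum_range_eq_Cv, ← sum_range_eq_Cv]
    simp
  loop a l hl := by simp [hG.loop a l hl]

theorem map_blockProd {M N : Type*} [CommMonoid M] [CommMonoid N] (f : M →* N)
    (G : S → List S → S → M) (a : S) (bls : List (List S)) (cs : List S) (b : S) :
    f (blockProd G a bls cs b) = blockProd (fun a l b => f (G a l b)) a bls cs b := by
  induction cs generalizing a bls with
  | nil =>
    match bls with
    | [] => simp [blockProd]
    | [bl] => simp [blockProd]
    | _ :: _ :: _ => simp [blockProd]
  | cons c cs ih =>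
    match bls with
    | [] => simp [blockProd]
    | bl :: bls => simp [blockProd, ih]

theorem Delta_ISym (a : S) (l : List S) (b : S) :
    Delta (ISym a l b) = ((marks l).map fun p =>
      ISym a p.1 b ⊗ₜ[ℚ] blockProd ISym a p.2 p.1 b).sum := by
  cases l with
  | nil => simp [ISym, marks, blockProd, Algebra.TensorProduct.one_def]
  | cons x l => simp [ISym, Delta]

theorem productMap_Delta {R : Type*} [CommRing R] [Algebra ℚ R] (f g : Itilde S →ₐ[ℚ] R)
    (a : S) (l : List S) (b : S) :
    Algebra.TensorProduct.productMap f g (Delta (ISym a l b)) =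
      comp (fun a l b => f (ISym a l b)) (fun a l b => g (ISym a l b)) a l b := by
  rw [Delta_ISym, map_list_sum, List.map_map]
  simp only [comp, T, Multiset.map_coe, Multiset.sum_coe]
  congr 1
  apply List.map_congr_left
  intro p _
  simp only [Function.comp, Algebra.TensorProduct.productMap_apply_tmul]
  congr 1
  exact map_blockProd (g : Itilde S →* R) _ _ _ _ _

theorem map_eq_productMap {A B : Type*} [CommRing A] [CommRing B] [Algebra ℚ A] [Algebra ℚ B]
    (f : A →ₐ[ℚ] B) (t : A ⊗[ℚ] A) :
    Algebra.TensorProduct.map f f t = Algebra.TensorProduct.productMap (S := B ⊗[ℚ] B)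
      ((Algebra.TensorProduct.includeLeft : B →ₐ[ℚ] B ⊗[ℚ] B).comp f)
      ((Algebra.TensorProduct.includeRight : B →ₐ[ℚ] B ⊗[ℚ] B).comp f) t := by
  induction t with
  | zero => simp only [map_zero]
  | add s t hs ht => simp only [map_add, hs, ht]
  | tmul s t => simp

theorem eps_ISym (a : S) (l : List S) (b : S) : eps (ISym a l b) = one a l b := by
  cases l with
  | nil => simp [ISym, one]
  | cons x l => simp [ISym, one, eps]

theorem one_char {R : Type*} [CommRing R] : IsChar (one : S → List S → S → R) where
  nil a b := by simp [one]
  shuf a b u v := by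
    cases u <;> cases v <;> simp [sh_nil_left, sh_nil_right, sh_cons, one]
    simp [sh]
  path a x b l := by
    cases l with
    | nil => simp [Cv, one]
    | cons x l =>
      simp only [Cv, one]
      simp
      have := Cv_mul_left (0 : R) (fun _ _ => 0) l
      simpa using this
  loop a l hl := by simp [one, hl]

/-! ### Grading -/

theorem ISym_hom (a : S) (l : List S) (b : S) :
    MvPolynomial.IsWeightedHomogeneous wdeg (ISym a l b) l.length := by
  cases l with
  | nil => exact MvPolynomial.isWeightedHomogeneous_one ℚ _
  | cons x l => exact MvPolynomial.isWeightedHomogeneous_X ℚ _ _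

theorem shuffles_length (n : ℕ) (u v : List S) (hn : u.length + v.length = n) :
    ∀ w ∈ shuffles u v, w.length = n := by
  induction n generalizing u v with
  | zero =>
    obtain rfl : u = [] := by cases u <;> simp_all
    simp [shuffles]; simpa using hn
  | succ n ih =>
    cases u with
    | nil => simp [shuffles]; simpa using hn
    | cons x u =>
    cases v with
    | nil => simp [shuffles]; simpa using hn
    | cons y v =>
      simp only [List.length_cons] at hn
      intro w hw
      simp only [shuffles, Multiset.mem_add, Multiset.mem_map] at hw
      rcases hw with ⟨w, hw, rfl⟩ | ⟨w, hw, rfl⟩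
      · simp [ih u (y :: v) (by simp; omega) w hw]
      · simp [ih (x :: u) v (by simp; omega) w hw]

theorem J_homogeneous (x : Itilde S) (hx : x ∈ Jideal S) (n : ℕ) :
    MvPolynomial.weightedHomogeneousComponent wdeg n x ∈ Jideal S := by
  let _ : GradedAlgebra (MvPolynomial.weightedHomogeneousSubmodule ℚ (wdeg (S := S))) :=
    MvPolynomial.weightedGradedAlgebra ℚ wdeg
  have h : (Jideal S).IsHomogeneous
      (MvPolynomial.weightedHomogeneousSubmodule ℚ (wdeg (S := S))) := by
    apply Ideal.homogeneous_span
    rintro p ((⟨a, b, l₁, l₂, rfl⟩ | ⟨a, b, x, l, rfl⟩) | ⟨a, l, hl, rfl⟩)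
    · refine ⟨l₁.length + l₂.length, ?_⟩
      apply Submodule.sub_mem
      · exact (ISym_hom _ _ _).mul (ISym_hom _ _ _)
      · apply multiset_sum_mem
        intro q hq
        obtain ⟨w, hw, rfl⟩ := Multiset.mem_map.mp hq
        rw [← shuffles_length _ l₁ l₂ rfl w hw]
        exact ISym_hom _ _ _
    · refine ⟨l.length, ?_⟩
      apply Submodule.sub_mem
      · exact ISym_hom _ _ _
      · apply Submodule.sum_mem
        intro k _
        have : l.length = (l.take k).length + (l.drop k).length := by
          rw [← List.length_append, List.take_append_drop]
        rw [this]
        exact (ISym_hom _ _ _).mul (ISym_hom _ _ _)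
    · exact ⟨l.length, ISym_hom _ _ _⟩
  exact MvPolynomial.weightedHomogeneousComponent_mem_of_mem ℚ wdeg h hx n

theorem blockProd_hom (a : S) (bls : List (List S)) (cs : List S) (b : S)
    (h : bls.length = cs.length + 1) :
    MvPolynomial.IsWeightedHomogeneous wdeg (blockProd ISym a bls cs b)
      (bls.map List.length).sum := by
  induction cs generalizing a bls with
  | nil =>
    match bls, h with
    | [bl], _ => simpa [blockProd] using ISym_hom a bl b
  | cons c cs ih =>
    match bls, h with
    | bl :: bls, h =>
      simp only [blockProd, List.map_cons, List.sum_cons]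
      exact (ISym_hom _ _ _).mul (ih c bls (by simpa using h))

theorem marks_weight (l : List S) :
    ∀ p ∈ marks l, p.1.length + (p.2.map List.length).sum = l.length := by
  induction l with
  | nil => simp [marks]
  | cons x l ih =>
    intro p hp
    simp only [marks, List.mem_append, List.mem_map] at hp
    rcases hp with ⟨q, hq, rfl⟩ | ⟨q, hq, rfl⟩
    · have := ih q hq
      simp; omega
    · have := ih q hq
      have h2 := marks_length l q hq
      obtain ⟨q1, q2⟩ := q
      cases q2 with
      | nil => simp at h2
      | cons y ys => simp at this ⊢; omega

/-- Degree `n` part of the tensor square. -/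
noncomputable def Kgr (S : Type*) (n : ℕ) : Submodule ℚ (Itilde S ⊗[ℚ] Itilde S) :=
  Submodule.span ℚ {t | ∃ (p q : ℕ) (x y : Itilde S), p + q = n ∧
    MvPolynomial.IsWeightedHomogeneous wdeg x p ∧
    MvPolynomial.IsWeightedHomogeneous wdeg y q ∧ t = x ⊗ₜ[ℚ] y}

theorem Kgr_mul {m n : ℕ} {s t : Itilde S ⊗[ℚ] Itilde S} (hs : s ∈ Kgr S m) (ht : t ∈ Kgr S n) :
    s * t ∈ Kgr S (m + n) := by
  have h : Kgr S m * Kgr S n ≤ Kgr S (m + n) := by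
    rw [Kgr, Kgr, Submodule.span_mul_span, Submodule.span_le]
    rintro _ ⟨_, ⟨p, q, x, y, rfl, hx, hy, rfl⟩, _, ⟨p', q', x', y', rfl, hx', hy', rfl⟩, rfl⟩
    exact Submodule.subset_span ⟨p + p', q + q', x * x', y * y', by omega, hx.mul hx', hy.mul hy',
      by simp⟩
  exact h (Submodule.mul_mem_mul hs ht)

theorem Delta_monomial (d : IGen S →₀ ℕ) :
    Delta (MvPolynomial.monomial d (1 : ℚ)) ∈ Kgr S (Finsupp.weight wdeg d) := by
  classical
  induction d using Finsupp.induction_linear with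
  | zero =>
    refine Submodule.subset_span ⟨0, 0, 1, 1, by simp, MvPolynomial.isWeightedHomogeneous_one ℚ _,
      MvPolynomial.isWeightedHomogeneous_one ℚ _, ?_⟩
    rw [show MvPolynomial.monomial (0 : IGen S →₀ ℕ) (1 : ℚ) = 1 from rfl, map_one]
    rfl
  | add f g hf hg =>
    have : MvPolynomial.monomial (f + g) (1 : ℚ) =
        MvPolynomial.monomial f 1 * MvPolynomial.monomial g 1 := by
      simp [MvPolynomial.monomial_mul]
    rw [this, map_mul, map_add]
    exact Kgr_mul hf hg
  | single g n =>
    induction n with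
    | zero =>
      refine Submodule.subset_span ⟨0, 0, 1, 1, by simp,
        MvPolynomial.isWeightedHomogeneous_one ℚ _,
        MvPolynomial.isWeightedHomogeneous_one ℚ _, ?_⟩
      rw [Finsupp.single_zero,
        show MvPolynomial.monomial (0 : IGen S →₀ ℕ) (1 : ℚ) = 1 from rfl, map_one]
      rfl
    | succ n ih =>
      have : MvPolynomial.monomial (Finsupp.single g (n + 1)) (1 : ℚ) =
          MvPolynomial.monomial (Finsupp.single g n) 1 * MvPolynomial.X g := by
        simp [MvPolynomial.X, MvPolynomial.monomial_mul]
      rw [this, map_mul, Finsupp.single_add, map_add]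
      refine Kgr_mul ih ?_
      rw [X_eq_ISym, Delta_ISym]
      apply list_sum_mem
      intro t ht
      obtain ⟨p, hp, rfl⟩ := List.mem_map.mp ht
      refine Submodule.subset_span ⟨_, _, _, _, ?_, ISym_hom _ _ _,
        blockProd_hom _ _ _ _ (marks_length _ p hp), rfl⟩
      rw [marks_weight _ p hp]
      simp [Finsupp.weight_single, wdeg]

theorem Delta_graded (n : ℕ) (x : Itilde S)
    (hx : x ∈ MvPolynomial.weightedHomogeneousSubmodule ℚ wdeg n) : Delta x ∈ Kgr S n := by
  rw [MvPolynomial.mem_weightedHomogeneousSubmodule] at hx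
  rw [MvPolynomial.as_sum x, map_sum]
  apply Submodule.sum_mem
  intro d hd
  have : MvPolynomial.monomial d (MvPolynomial.coeff d x) =
      (MvPolynomial.coeff d x) • MvPolynomial.monomial d (1 : ℚ) := by
    simp [MvPolynomial.smul_monomial]
  rw [this, map_smul]
  apply Submodule.smul_mem
  have h := hx (MvPolynomial.mem_support_iff.mp hd)
  rw [← h]
  exact Delta_monomial d

end Final

set_option maxHeartbeats 1000000 in
set_option synthInstance.maxHeartbeats 400000 in
theorem Jideal_is_graded_coideal (S : Type*) :
    -- J is a homogeneous ideal
    (∀ x ∈ Jideal S, ∀ n : ℕ,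
      MvPolynomial.weightedHomogeneousComponent wdeg n x ∈ Jideal S) ∧
    -- Δ(J) ⊆ J ⊗ 𝕀̃(S) + 𝕀̃(S) ⊗ J
    (∀ x ∈ Jideal S,
      Delta x ∈
        LinearMap.range (TensorProduct.mapIncl
          ((Jideal S).restrictScalars ℚ) (⊤ : Submodule ℚ (Itilde S))) ⊔
        LinearMap.range (TensorProduct.mapIncl
          (⊤ : Submodule ℚ (Itilde S)) ((Jideal S).restrictScalars ℚ))) ∧
    -- ε(J) = 0
    (∀ x ∈ Jideal S, eps x = 0) ∧
    -- consequently Δ and ε descend to 𝕀(S) = 𝕀̃(S)/J, making it a graded Hopf algebra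
    (∃ (Δq : IS S →ₐ[ℚ] IS S ⊗[ℚ] IS S) (εq : IS S →ₐ[ℚ] ℚ),
      (∀ x : Itilde S,
        Δq (Ideal.Quotient.mkₐ ℚ (Jideal S) x) =
          (Algebra.TensorProduct.map
            (Ideal.Quotient.mkₐ ℚ (Jideal S)) (Ideal.Quotient.mkₐ ℚ (Jideal S))) (Delta x)) ∧
      (∀ x : Itilde S, εq (Ideal.Quotient.mkₐ ℚ (Jideal S) x) = eps x) ∧
      -- Δq respects the induced grading
      (∀ (n : ℕ) (x : Itilde S), x ∈ MvPolynomial.weightedHomogeneousSubmodule ℚ wdeg n →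
        Δq (Ideal.Quotient.mkₐ ℚ (Jideal S) x) ∈
          ⨆ (pq : ℕ × ℕ) (_ : pq.1 + pq.2 = n),
            LinearMap.range (TensorProduct.mapIncl
              ((MvPolynomial.weightedHomogeneousSubmodule ℚ wdeg pq.1).map
                (Ideal.Quotient.mkₐ ℚ (Jideal S)).toLinearMap)
              ((MvPolynomial.weightedHomogeneousSubmodule ℚ wdeg pq.2).map
                (Ideal.Quotient.mkₐ ℚ (Jideal S)).toLinearMap))) ∧
      -- and 𝕀(S) has an antipode
      (∃ antipode : IS S →ₗ[ℚ] IS S,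
        (∀ y, (LinearMap.mul' ℚ (IS S)) ((TensorProduct.map antipode LinearMap.id) (Δq y)) =
          algebraMap ℚ (IS S) (εq y)) ∧
        (∀ y, (LinearMap.mul' ℚ (IS S)) ((TensorProduct.map LinearMap.id antipode) (Δq y)) =
          algebraMap ℚ (IS S) (εq y)))) := by
  have hD : ∀ x ∈ Jideal S, ((Algebra.TensorProduct.map
      (Ideal.Quotient.mkₐ ℚ (Jideal S)) (Ideal.Quotient.mkₐ ℚ (Jideal S))).comp Delta) x = 0 := by
    refine J_le_of_char (R := IS S ⊗[ℚ] IS S) ((Algebra.TensorProduct.map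
      (Ideal.Quotient.mkₐ ℚ (Jideal S)) (Ideal.Quotient.mkₐ ℚ (Jideal S))).comp Delta) ?_
    simp only [AlgHom.comp_apply, map_eq_productMap, productMap_Delta]
    exact (mk_char.map _).comp (mk_char.map _)
  have hE : ∀ x ∈ Jideal S, eps x = 0 := by
    apply J_le_of_char
    simp only [eps_ISym]
    exact one_char
  obtain ⟨L, hL, hL1, hL2⟩ := exists_inv (mk_char (S := S))
  have hLJ : ∀ x ∈ Jideal S, ev L x = 0 := by
    apply J_le_of_char
    simp only [ev_ISym L hL.nil]
    exact hL
  refine ⟨J_homogeneous, ?_, hE, Ideal.Quotient.liftₐ (Jideal S) _ hD,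
    Ideal.Quotient.liftₐ (Jideal S) eps hE, fun x => rfl, fun x => rfl, ?_,
    (Ideal.Quotient.liftₐ (Jideal S) (ev L) hLJ).toLinearMap, ?_, ?_⟩
  · intro x hx
    have h := hD x hx
    have hker := TensorProduct.map_ker
      (LinearMap.exact_subtype_mkQ ((Jideal S).restrictScalars ℚ))
      (Submodule.mkQ_surjective _)
      (LinearMap.exact_subtype_mkQ ((Jideal S).restrictScalars ℚ))
      (Submodule.mkQ_surjective _)
    have h2 : Delta x ∈ LinearMap.ker (TensorProduct.map
        ((Jideal S).restrictScalars ℚ).mkQ ((Jideal S).restrictScalars ℚ).mkQ) := h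
    rw [hker] at h2
    refine SetLike.le_def.mp (sup_le ?_ ?_) h2
    · refine le_trans ?_ le_sup_right
      rintro _ ⟨t, rfl⟩
      induction t with
      | zero => simp
      | add s t hs ht => rw [map_add]; exact Submodule.add_mem _ hs ht
      | tmul s t => exact ⟨⟨s, trivial⟩ ⊗ₜ t, rfl⟩
    · refine le_trans ?_ le_sup_left
      rintro _ ⟨t, rfl⟩
      induction t with
      | zero => simp
      | add s t hs ht => rw [map_add]; exact Submodule.add_mem _ hs ht
      | tmul s t => exact ⟨s ⊗ₜ ⟨t, trivial⟩, rfl⟩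
  · intro n x hx
    have h := Delta_graded n x hx
    change (Algebra.TensorProduct.map (Ideal.Quotient.mkₐ ℚ (Jideal S))
      (Ideal.Quotient.mkₐ ℚ (Jideal S))).toLinearMap (Delta x) ∈ _
    generalize Delta x = t at h
    rw [Kgr] at h
    induction h using Submodule.span_induction with
    | zero => rw [map_zero]; exact Submodule.zero_mem _
    | add s t _ _ hs ht => rw [map_add]; exact Submodule.add_mem _ hs ht
    | smul r t _ ht => rw [map_smul]; exact Submodule.smul_mem _ _ ht
    | mem t ht =>
      obtain ⟨p, q, x, y, hpq, hx, hy, rfl⟩ := ht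
      refine Submodule.mem_iSup_of_mem (p, q) (Submodule.mem_iSup_of_mem hpq ?_)
      exact ⟨⟨_, x, hx, rfl⟩ ⊗ₜ ⟨_, y, hy, rfl⟩, rfl⟩
  · intro y
    obtain ⟨x, rfl⟩ := Ideal.Quotient.mkₐ_surjective ℚ (Jideal S) y
    have key : (Algebra.TensorProduct.productMap (ev L) (Ideal.Quotient.mkₐ ℚ (Jideal S))).comp
        Delta = (Algebra.ofId ℚ (IS S)).comp eps := by
      apply hom_ext_ISym
      intro a l b
      rw [AlgHom.comp_apply, productMap_Delta, AlgHom.comp_apply, eps_ISym]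
      simp only [ev_ISym L hL.nil]
      rw [show (fun a l b => L a l b) = L from rfl, hL1]
      simp only [one]
      split_ifs <;> simp
    have h := DFunLike.congr_fun key x
    refine Eq.trans ?_ h
    change _ = Algebra.TensorProduct.productMap (ev L) (Ideal.Quotient.mkₐ ℚ (Jideal S)) (Delta x)
    change (LinearMap.mul' ℚ (IS S)) ((TensorProduct.map
      (Ideal.Quotient.liftₐ (Jideal S) (ev L) hLJ).toLinearMap LinearMap.id)
      ((Algebra.TensorProduct.map
        (Ideal.Quotient.mkₐ ℚ (Jideal S)) (Ideal.Quotient.mkₐ ℚ (Jideal S))) (Delta x))) = _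
    generalize Delta x = t
    induction t with
    | zero => simp only [map_zero]
    | add s t hs ht => simp only [map_add, hs, ht]
    | tmul s t => rfl
  · intro y
    obtain ⟨x, rfl⟩ := Ideal.Quotient.mkₐ_surjective ℚ (Jideal S) y
    have key : (Algebra.TensorProduct.productMap (Ideal.Quotient.mkₐ ℚ (Jideal S)) (ev L)).comp
        Delta = (Algebra.ofId ℚ (IS S)).comp eps := by
      apply hom_ext_ISym
      intro a l b
      rw [AlgHom.comp_apply, productMap_Delta, AlgHom.comp_apply, eps_ISym]
      simp only [ev_ISym L hL.nil]
      rw [show (fun a l b => L a l b) = L from rfl, hL2]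
      simp only [one]
      split_ifs <;> simp
    have h := DFunLike.congr_fun key x
    refine Eq.trans ?_ h
    change _ = Algebra.TensorProduct.productMap (Ideal.Quotient.mkₐ ℚ (Jideal S)) (ev L) (Delta x)
    change (LinearMap.mul' ℚ (IS S)) ((TensorProduct.map LinearMap.id
      (Ideal.Quotient.liftₐ (Jideal S) (ev L) hLJ).toLinearMap)
      ((Algebra.TensorProduct.map
        (Ideal.Quotient.mkₐ ℚ (Jideal S)) (Ideal.Quotient.mkₐ ℚ (Jideal S))) (Delta x))) = _
    generalize Delta x = t
    induction t with
    | zero => simp only [map_zero]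
    | add s t hs ht => simp only [map_add, hs, ht]
    | tmul s t => rfl
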